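/- There exist absolute constants C, c, c₁, C₁ > 0 such that the following holds. Let X = (ℝⁿ, ‖·‖) be a normed space whose unit ball is in John's position, and for m with c₁·k(X) ≤ m ≤ C₁·k(X) define the norm ‖(x; z)‖_Y = max{ ‖x‖, ‖z‖₂ } on ℝ^{n+m}. Then for all t > 0, c·exp(−C t² k(X)) ≤ P( | ‖G‖_Y − E‖G‖_Y | > t · E‖G‖_Y ) ≤ C·exp(−c t² k(X)), where G ~ N(0, I_{n+m}). -/

import Mathlib

open MeasureTheory ProbabilityTheory Real

/-- The standard Gaussian measure `γ_d` on `ℝᵈ`. -/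
noncomputable def stdGaussian (d : ℕ) : Measure (Fin d → ℝ) :=
  Measure.pi fun _ => gaussianReal 0 1

/-- The Euclidean norm on `ℝᵈ`. -/
noncomputable def euclNorm {d : ℕ} (x : Fin d → ℝ) : ℝ :=
  Real.sqrt (∑ i, (x i) ^ 2)

/-- `b(X) = max{ N θ : ‖θ‖₂ = 1 }`, the Lipschitz constant of the norm `N`. -/
noncomputable def bConst {d : ℕ} (N : (Fin d → ℝ) → ℝ) : ℝ :=
  sSup {s | ∃ θ : Fin d → ℝ, euclNorm θ = 1 ∧ s = N θ}

/-- The critical dimension (Dvoretzky number) `k(X) = (E N(G) / b(X))²`. -/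
noncomputable def critDim (d : ℕ) (N : (Fin d → ℝ) → ℝ) : ℝ :=
  ((∫ x, N x ∂stdGaussian d) / bConst N) ^ 2

/-- The unit ball of `N` is in John's position: the Euclidean unit ball is contained in
it, and any affine image of the Euclidean unit ball contained in it has volume at most
that of the Euclidean unit ball. -/
def JohnPosition {d : ℕ} (N : (Fin d → ℝ) → ℝ) : Prop :=
  (∀ x, euclNorm x ≤ 1 → N x ≤ 1) ∧
  ∀ (T : (Fin d → ℝ) →ₗ[ℝ] (Fin d → ℝ)) (v : Fin d → ℝ),
    (∀ x, euclNorm x ≤ 1 → N (T x + v) ≤ 1) →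
    MeasureTheory.volume ((fun x => T x + v) '' {x | euclNorm x ≤ 1})
      ≤ MeasureTheory.volume {x : Fin d → ℝ | euclNorm x ≤ 1}

/-- The norm `‖(x;z)‖_Y = max{N(x), ‖z‖₂}` of `Y = (X ⊕ ℓ₂ᵐ)_∞` on `ℝ^{n+m}`. -/
noncomputable def normY (n m : ℕ) (N : (Fin n → ℝ) → ℝ) (y : Fin (n + m) → ℝ) : ℝ :=
  max (N fun i => y (Fin.castAdd m i)) (euclNorm fun j : Fin m => y (Fin.natAdd n j))

section EuclideanNorm

variable {d : ℕ}

lemma euclNorm_eq_norm_toLp (x : Fin d → ℝ) : euclNorm x = ‖WithLp.toLp 2 x‖ := by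
  simp [euclNorm, EuclideanSpace.norm_eq]

lemma euclNorm_nonneg (x : Fin d → ℝ) : 0 ≤ euclNorm x := Real.sqrt_nonneg _

lemma sq_euclNorm (x : Fin d → ℝ) : euclNorm x ^ 2 = ∑ i, x i ^ 2 :=
  Real.sq_sqrt (Finset.sum_nonneg fun _ _ => sq_nonneg _)

lemma euclNorm_add_le (x y : Fin d → ℝ) : euclNorm (x + y) ≤ euclNorm x + euclNorm y := by
  simpa only [euclNorm_eq_norm_toLp, WithLp.toLp_add] using norm_add_le _ _

lemma euclNorm_smul (r : ℝ) (x : Fin d → ℝ) : euclNorm (r • x) = |r| * euclNorm x := by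
  simp [euclNorm_eq_norm_toLp, WithLp.toLp_smul, norm_smul]

lemma abs_euclNorm_sub_euclNorm_le (x y : Fin d → ℝ) :
    |euclNorm x - euclNorm y| ≤ euclNorm (x - y) := by
  simpa only [euclNorm_eq_norm_toLp, WithLp.toLp_sub] using abs_norm_sub_norm_le _ _

lemma abs_apply_le_euclNorm (x : Fin d → ℝ) (i : Fin d) : |x i| ≤ euclNorm x := by
  rw [euclNorm_eq_norm_toLp]
  exact PiLp.norm_apply_le (WithLp.toLp 2 x) i

lemma sum_abs_le_sqrt_mul_euclNorm (x : Fin d → ℝ) : ∑ i, |x i| ≤ √d * euclNorm x := by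
  rw [euclNorm, ← Real.sqrt_mul (Nat.cast_nonneg d)]
  refine Real.le_sqrt_of_sq_le ?_
  simpa using sq_sum_le_card_mul_sum_sq (s := Finset.univ) (f := fun i => |x i|)

lemma euclNorm_le_sum_abs (x : Fin d → ℝ) : euclNorm x ≤ ∑ i, |x i| := by
  refine Real.sqrt_le_iff.2 ⟨by positivity, ?_⟩
  simpa using Finset.sum_sq_le_sq_sum_of_nonneg (s := Finset.univ) (f := fun i => |x i|)
    fun i _ => abs_nonneg _

lemma euclNorm_le_card_mul_norm (x : Fin d → ℝ) : euclNorm x ≤ d * ‖x‖ := by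
  calc euclNorm x ≤ ∑ i, |x i| := euclNorm_le_sum_abs x
    _ ≤ ∑ _i : Fin d, ‖x‖ := Finset.sum_le_sum fun i _ => norm_le_pi_norm x i
    _ = d * ‖x‖ := by simp

lemma continuous_euclNorm : Continuous (euclNorm : (Fin d → ℝ) → ℝ) := by
  unfold euclNorm; fun_prop

lemma euclNorm_comp_le {k : ℕ} {e : Fin k → Fin d} (he : e.Injective) (x : Fin d → ℝ) :
    euclNorm (x ∘ e) ≤ euclNorm x := by
  refine Real.sqrt_le_sqrt ?_
  calc ∑ i, (x ∘ e) i ^ 2 = ∑ j ∈ Finset.univ.map ⟨e, he⟩, x j ^ 2 := by simp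
    _ ≤ ∑ j, x j ^ 2 := Finset.sum_le_univ_sum_of_nonneg fun j => sq_nonneg _

/-- A function that is `1`-Lipschitz for the Euclidean norm is Lipschitz for the sup norm. -/
lemma lipschitzWith_of_abs_sub_le_euclNorm {f : (Fin d → ℝ) → ℝ}
    (hf : ∀ x y, |f x - f y| ≤ euclNorm (x - y)) : LipschitzWith d f :=
  LipschitzWith.of_dist_le_mul fun x y => by
    rw [Real.dist_eq, dist_eq_norm]
    exact (hf x y).trans (by simpa using euclNorm_le_card_mul_norm (x - y))

end EuclideanNorm

section GaussianMeasure

variable {d : ℕ}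

instance isProbabilityMeasure_stdGaussian_pi : IsProbabilityMeasure (stdGaussian d) := by
  unfold _root_.stdGaussian; infer_instance

lemma measurePreserving_eval_stdGaussian (i : Fin d) :
    MeasurePreserving (fun x : Fin d → ℝ => x i) (stdGaussian d) (gaussianReal 0 1) :=
  measurePreserving_eval (fun _ => gaussianReal 0 1) i

lemma integral_comp_eval_stdGaussian (g : ℝ → ℝ)
    (hg : AEStronglyMeasurable g (gaussianReal 0 1)) (i : Fin d) :
    ∫ x, g (x i) ∂stdGaussian d = ∫ x, g x ∂gaussianReal 0 1 := by
  have h := measurePreserving_eval_stdGaussian i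
  rw [← h.map_eq] at hg ⊢
  exact (integral_map h.aemeasurable hg).symm

lemma integral_eval_stdGaussian (i : Fin d) : ∫ x, x i ∂stdGaussian d = 0 := by
  rw [integral_comp_eval_stdGaussian (fun x => x) (by fun_prop), integral_id_gaussianReal]

lemma iIndepFun_eval_stdGaussian :
    iIndepFun (fun (i : Fin d) (x : Fin d → ℝ) => x i) (stdGaussian d) :=
  iIndepFun_pi (X := fun _ x => x) fun _ => aemeasurable_id

instance isGaussian_stdGaussian_pi : IsGaussian (stdGaussian d) := by
  have h : HasGaussianLaw (fun (x : Fin d → ℝ) i => x i) (stdGaussian d) :=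
    iIndepFun.hasGaussianLaw
      (fun i => ⟨by rw [(measurePreserving_eval_stdGaussian i).map_eq]; infer_instance⟩)
      iIndepFun_eval_stdGaussian
  simpa using h.isGaussian_map

/-- Selecting distinct coordinates of a standard Gaussian vector gives a standard Gaussian
vector. -/
lemma measurePreserving_comp_stdGaussian {k : ℕ} {e : Fin k → Fin d} (he : e.Injective) :
    MeasurePreserving (fun x : Fin d → ℝ => x ∘ e) (stdGaussian d) (stdGaussian k) where
  measurable := by unfold Function.comp; fun_prop
  map_eq := by
    have h := (iIndepFun_iff_map_fun_eq_pi_map fun i => (measurable_pi_apply (e i)).aemeasurable).1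
      (iIndepFun_eval_stdGaussian.precomp he)
    simp only [(measurePreserving_eval_stdGaussian _).map_eq] at h
    exact h

/-- The density of the standard Gaussian measure on `ℝᵈ`. -/
lemma stdGaussian_eq_withDensity :
    stdGaussian d =
      volume.withDensity fun x => ENNReal.ofReal (∏ i, gaussianPDFReal 0 1 (x i)) := by
  refine Measure.pi_eq fun s hs => ?_
  rw [withDensity_apply _ (MeasurableSet.univ_pi hs), volume_pi, Measure.restrict_pi_pi,
    ← ofReal_integral_eq_lintegral_ofReal
      (Integrable.fintype_prod fun i => (integrable_gaussianPDFReal 0 1).restrict)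
      (ae_of_all _ fun x => Finset.prod_nonneg fun i _ => gaussianPDFReal_nonneg _ _ _),
    integral_fintype_prod_eq_prod, ENNReal.ofReal_prod_of_nonneg
      fun i _ => integral_nonneg fun x => gaussianPDFReal_nonneg _ _ _]
  simp only [gaussianReal_apply_eq_integral 0 one_ne_zero]

lemma stdGaussian_absolutelyContinuous : stdGaussian d ≪ volume := by
  rw [stdGaussian_eq_withDensity]
  exact withDensity_absolutelyContinuous _ _

lemma prod_gaussianPDFReal_eq (x : Fin d → ℝ) :
    ∏ i, gaussianPDFReal 0 1 (x i) = (√(2 * π))⁻¹ ^ d * exp (-euclNorm x ^ 2 / 2) := by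
  simp only [gaussianPDFReal_def, Finset.prod_mul_distrib, ← Real.exp_sum, sq_euclNorm]
  simp [Finset.sum_div, neg_div]

/-- A standard Gaussian pair is invariant under rotations. -/
lemma measurePreserving_rotation_stdGaussian (θ : ℝ) :
    MeasurePreserving (ContinuousLinearMap.rotation θ)
      ((stdGaussian d).prod (stdGaussian d)) ((stdGaussian d).prod (stdGaussian d)) where
  measurable := by fun_prop
  map_eq := by
    have hid : Integrable id (stdGaussian d) := IsGaussian.integrable_id
    refine IsGaussian.map_rotation_eq_self ?_ θ
    ext i
    rw [eval_integral fun i => Integrable.eval hid i]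
    simp [integral_eval_stdGaussian]

lemma integrable_exp_mul_euclNorm (c : ℝ) :
    Integrable (fun x => exp (c * euclNorm x)) (stdGaussian d) := by
  have h (i : Fin d) : Integrable (fun x => exp (|c| * x) + exp (-|c| * x)) (gaussianReal 0 1) :=
    (integrable_exp_mul_gaussianReal _).add (integrable_exp_mul_gaussianReal _)
  refine (Integrable.fintype_prod h).mono' (by have := continuous_euclNorm (d := d); fun_prop)
    (ae_of_all _ fun x => ?_)
  rw [Real.norm_of_nonneg (exp_pos _).le]
  calc exp (c * euclNorm x) ≤ exp (∑ i, |c| * |x i|) := by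
        rw [exp_le_exp, ← Finset.mul_sum]
        exact (mul_le_mul_of_nonneg_right (le_abs_self c) (euclNorm_nonneg x)).trans
          (mul_le_mul_of_nonneg_left (euclNorm_le_sum_abs x) (abs_nonneg c))
    _ = ∏ i, exp (|c| * |x i|) := Real.exp_sum _ _
    _ ≤ ∏ i, (exp (|c| * x i) + exp (-|c| * x i)) := by
        refine Finset.prod_le_prod (fun i _ => (exp_pos _).le) fun i _ => ?_
        rcases abs_cases (x i) with ⟨h, _⟩ | ⟨h, _⟩ <;> rw [h]
        · exact le_add_of_nonneg_right (exp_pos _).le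
        · rw [mul_neg, ← neg_mul]
          exact le_add_of_nonneg_left (exp_pos _).le

end GaussianMeasure

section Concentration

open Filter Topology

variable {d : ℕ} {f : (Fin d → ℝ) → ℝ}

/-- The increment of `f` along the rotation of angle `θ` from `p.1` towards `p.2`. -/
noncomputable def rotationIncrement (f : (Fin d → ℝ) → ℝ) (θ : ℝ)
    (p : (Fin d → ℝ) × (Fin d → ℝ)) : ℝ :=
  f (cos θ • p.1 + sin θ • p.2) - f p.1

lemma continuous_rotationIncrement (hf : Continuous f) (θ : ℝ) :
    Continuous (rotationIncrement f θ) := by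
  unfold rotationIncrement; fun_prop

lemma abs_rotationIncrement_le (hf : ∀ x y, |f x - f y| ≤ euclNorm (x - y)) (θ : ℝ)
    (p : (Fin d → ℝ) × (Fin d → ℝ)) :
    |rotationIncrement f θ p| ≤ |θ| * (euclNorm p.1 + euclNorm p.2) := by
  have hcos : |cos θ - 1| ≤ |θ| := by simpa using abs_cos_sub_cos_le θ 0
  have hsin : |sin θ| ≤ |θ| := abs_sin_le_abs
  calc |rotationIncrement f θ p| ≤ euclNorm (cos θ • p.1 + sin θ • p.2 - p.1) := hf _ _
    _ = euclNorm ((cos θ - 1) • p.1 + sin θ • p.2) := by congr 1; module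
    _ ≤ |cos θ - 1| * euclNorm p.1 + |sin θ| * euclNorm p.2 := by
        simpa only [euclNorm_smul] using euclNorm_add_le ((cos θ - 1) • p.1) (sin θ • p.2)
    _ ≤ |θ| * euclNorm p.1 + |θ| * euclNorm p.2 :=
        add_le_add (mul_le_mul_of_nonneg_right hcos (euclNorm_nonneg _))
          (mul_le_mul_of_nonneg_right hsin (euclNorm_nonneg _))
    _ = |θ| * (euclNorm p.1 + euclNorm p.2) := by ring

lemma integrable_exp_mul_euclNorm_add_euclNorm (c : ℝ) :
    Integrable (fun p : (Fin d → ℝ) × (Fin d → ℝ) => exp (c * (euclNorm p.1 + euclNorm p.2)))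
      ((stdGaussian d).prod (stdGaussian d)) := by
  simpa only [mul_add, exp_add] using
    (integrable_exp_mul_euclNorm (d := d) c).mul_prod (integrable_exp_mul_euclNorm (d := d) c)

lemma integrable_exp_of_abs_le {φ : (Fin d → ℝ) × (Fin d → ℝ) → ℝ} (c : ℝ)
    (hφ : AEStronglyMeasurable φ ((stdGaussian d).prod (stdGaussian d)))
    (h : ∀ p, |φ p| ≤ c * (euclNorm p.1 + euclNorm p.2)) :
    Integrable (fun p => exp (φ p)) ((stdGaussian d).prod (stdGaussian d)) :=
  (integrable_exp_mul_euclNorm_add_euclNorm c).mono' (continuous_exp.comp_aestronglyMeasurable hφ)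
    (ae_of_all _ fun p => by
      rw [Real.norm_of_nonneg (exp_pos _).le, exp_le_exp]
      exact (le_abs_self _).trans (h p))

lemma integrable_exp_mul_rotationIncrement (hf : ∀ x y, |f x - f y| ≤ euclNorm (x - y))
    (c θ : ℝ) :
    Integrable (fun p => exp (c * rotationIncrement f θ p))
      ((stdGaussian d).prod (stdGaussian d)) := by
  have hc := continuous_rotationIncrement (lipschitzWith_of_abs_sub_le_euclNorm hf).continuous θ
  refine integrable_exp_of_abs_le (|c| * |θ|) (by fun_prop) fun p => ?_
  rw [abs_mul, mul_assoc]
  exact mul_le_mul_of_nonneg_left (abs_rotationIncrement_le hf θ p) (abs_nonneg c)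

lemma rotationIncrement_rotation (θ φ : ℝ) (p : (Fin d → ℝ) × (Fin d → ℝ)) :
    rotationIncrement f θ (ContinuousLinearMap.rotation φ p) =
      f (cos (φ + θ) • p.1 + sin (φ + θ) • p.2) - f (cos φ • p.1 + sin φ • p.2) := by
  have : cos θ • (cos φ • p.1 + sin φ • p.2) + sin θ • (-sin φ • p.1 + cos φ • p.2) =
      cos (φ + θ) • p.1 + sin (φ + θ) • p.2 := by
    rw [cos_add, sin_add]; module
  simp only [rotationIncrement, ContinuousLinearMap.rotation_apply, this]

/-- Splitting a quarter turn into `M` equal rotations and using convexity of `exp`, the exponential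
moment of `f Y - f X` is controlled by that of `M` times a single small increment. -/
lemma integral_exp_sub_le_integral_exp_rotationIncrement
    (hf : ∀ x y, |f x - f y| ≤ euclNorm (x - y)) (c : ℝ) {M : ℕ} (hM : M ≠ 0) :
    ∫ p, exp (c * rotationIncrement f (π / 2) p) ∂(stdGaussian d).prod (stdGaussian d) ≤
      ∫ p, exp (c * M * rotationIncrement f (π / 2 / M) p)
        ∂(stdGaussian d).prod (stdGaussian d) := by
  set h : ℝ := π / 2 / M
  have hM' : (M : ℝ) ≠ 0 := by exact_mod_cast hM
  let D (j : ℕ) (p : (Fin d → ℝ) × (Fin d → ℝ)) : ℝ :=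
    rotationIncrement f h (ContinuousLinearMap.rotation (j * h) p)
  have hsum (p) : rotationIncrement f (π / 2) p = ∑ j ∈ Finset.range M, D j p := by
    have (j : ℕ) : D j p = f (cos ((j + 1 : ℕ) * h) • p.1 + sin ((j + 1 : ℕ) * h) • p.2) -
        f (cos (j * h) • p.1 + sin (j * h) • p.2) := by
      rw [Nat.cast_add_one, add_one_mul]
      exact rotationIncrement_rotation _ _ _
    simp only [this]
    rw [Finset.sum_range_sub (fun j : ℕ => f (cos (j * h) • p.1 + sin (j * h) • p.2)),
      mul_div_cancel₀ _ hM']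
    simp [rotationIncrement]
  have hmp (j : ℕ) := measurePreserving_rotation_stdGaussian (d := d) (j * h)
  have hint := integrable_exp_mul_rotationIncrement hf (c * M) h
  have hintD (j : ℕ) : Integrable (fun p => exp (c * M * D j p))
      ((stdGaussian d).prod (stdGaussian d)) := (hmp j).integrable_comp_of_integrable hint
  have hD (j : ℕ) : ∫ p, exp (c * M * D j p) ∂(stdGaussian d).prod (stdGaussian d) =
      ∫ p, exp (c * M * rotationIncrement f h p) ∂(stdGaussian d).prod (stdGaussian d) := by
    have hint' := hint.aestronglyMeasurable
    rw [← (hmp j).map_eq] at hint'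
    conv_rhs => rw [← (hmp j).map_eq]
    exact (integral_map (hmp j).aemeasurable hint').symm
  calc ∫ p, exp (c * rotationIncrement f (π / 2) p) ∂(stdGaussian d).prod (stdGaussian d)
      ≤ ∫ p, ∑ j ∈ Finset.range M, (M : ℝ)⁻¹ * exp (c * M * D j p)
          ∂(stdGaussian d).prod (stdGaussian d) := by
        refine integral_mono (integrable_exp_mul_rotationIncrement hf c _)
          (integrable_finsetSum _ fun j _ => (hintD j).const_mul _) fun p => ?_
        have := convexOn_exp.map_sum_le (t := Finset.range M) (w := fun _ => (M : ℝ)⁻¹)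
          (p := fun j => c * M * D j p) (fun _ _ => by positivity)
          (by simp [hM']) (fun _ _ => Set.mem_univ _)
        simp only [smul_eq_mul] at this
        convert this using 2
        rw [hsum, Finset.mul_sum]
        refine Finset.sum_congr rfl fun j _ => ?_
        field_simp
    _ = ∫ p, exp (c * M * rotationIncrement f h p) ∂(stdGaussian d).prod (stdGaussian d) := by
        rw [integral_finsetSum _ fun j _ => (hintD j).const_mul _]
        simp only [integral_const_mul, hD, Finset.sum_const, Finset.card_range, nsmul_eq_mul]
        field_simp

lemma abs_fderiv_apply_le (hf : ∀ x y, |f x - f y| ≤ euclNorm (x - y)) (x y : Fin d → ℝ) :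
    |fderiv ℝ f x y| ≤ euclNorm y := by
  by_cases hx : DifferentiableAt ℝ f x
  · have hline : HasDerivAt (fun t : ℝ => x + t • y) y 0 := by
      simpa using ((hasDerivAt_id (0 : ℝ)).smul_const y).const_add x
    have hx' : HasFDerivAt f (fderiv ℝ f x) (x + (0 : ℝ) • y) := by simpa using hx.hasFDerivAt
    refine (hx'.comp_hasDerivAt (0 : ℝ) hline).le_of_lip' (euclNorm_nonneg y)
      (Eventually.of_forall fun t => ?_)
    refine (hf _ _).trans_eq ?_
    simp only [zero_smul, add_zero, add_sub_cancel_left]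
    rw [euclNorm_smul, sub_zero, mul_comm, Real.norm_eq_abs]
  · simp [fderiv_zero_of_not_differentiableAt hx, euclNorm_nonneg]

lemma tendsto_mul_rotationIncrement {p : (Fin d → ℝ) × (Fin d → ℝ)}
    (hp : DifferentiableAt ℝ f p.1) :
    Tendsto (fun n : ℕ => ((n + 1 : ℕ) : ℝ) * rotationIncrement f (π / 2 / (n + 1 : ℕ)) p) atTop
      (𝓝 (π / 2 * fderiv ℝ f p.1 p.2)) := by
  have hcurve : HasDerivAt (fun θ : ℝ => cos θ • p.1 + sin θ • p.2) p.2 0 := by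
    simpa [Pi.add_def] using
      ((hasDerivAt_cos 0).smul_const p.1).add ((hasDerivAt_sin 0).smul_const p.2)
  have hp' : HasFDerivAt f (fderiv ℝ f p.1) (cos 0 • p.1 + sin 0 • p.2) := by
    simpa using hp.hasFDerivAt
  have hslope := hasDerivAt_iff_tendsto_slope_zero.1 (hp'.comp_hasDerivAt (0 : ℝ) hcurve)
  have hθ : Tendsto (fun n : ℕ => π / 2 / ((n + 1 : ℕ) : ℝ)) atTop (𝓝[≠] 0) := by
    refine tendsto_nhdsWithin_iff.2 ⟨?_, Eventually.of_forall fun n => ?_⟩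
    · exact (tendsto_const_div_atTop_nhds_zero_nat (π / 2)).comp (tendsto_add_atTop_nat 1)
    · exact (by positivity : (0 : ℝ) < π / 2 / ((n + 1 : ℕ) : ℝ)).ne'
  refine ((hslope.comp hθ).const_mul (π / 2)).congr fun n => ?_
  simp only [Function.comp, rotationIncrement, zero_add, smul_eq_mul, cos_zero, sin_zero, one_smul,
    zero_smul, add_zero]
  field_simp

/-- Exponential moments of a linear functional of a standard Gaussian vector. -/
lemma integral_exp_clm_le (L : (Fin d → ℝ) →L[ℝ] ℝ) (hL : ∀ y, |L y| ≤ euclNorm y) (s : ℝ) :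
    ∫ y, exp (s * L y) ∂stdGaussian d ≤ exp (s ^ 2 / 2) := by
  let v : Fin d → ℝ := fun i => L (Pi.single i 1)
  have hLv (y : Fin d → ℝ) : L y = ∑ i, v i * y i := by
    conv_lhs => rw [← Finset.univ_sum_single y, map_sum]
    refine Finset.sum_congr rfl fun i _ => ?_
    rw [mul_comm, ← smul_eq_mul, ← map_smul, ← Pi.single_smul, smul_eq_mul, mul_one]
  have hv : euclNorm v ^ 2 ≤ 1 := by
    have h1 := (le_abs_self _).trans (hL v)
    have h2 : L v = euclNorm v ^ 2 := by rw [hLv, sq_euclNorm]; simp only [sq]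
    nlinarith [euclNorm_nonneg v]
  calc ∫ y, exp (s * L y) ∂stdGaussian d = ∫ y, ∏ i, exp (s * v i * y i) ∂stdGaussian d := by
        simp only [hLv, Finset.mul_sum, exp_sum, mul_assoc]
    _ = ∏ i, ∫ x, exp (s * v i * x) ∂gaussianReal 0 1 :=
        integral_fintype_prod_eq_prod (fun i x => exp (s * v i * x))
    _ = exp (s ^ 2 / 2 * euclNorm v ^ 2) := by
        have (t : ℝ) : ∫ x, exp (t * x) ∂gaussianReal 0 1 = exp (t ^ 2 / 2) := by
          simpa [mgf] using congrFun (mgf_fun_id_gaussianReal (μ := 0) (v := 1)) t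
        simp only [this]
        rw [← exp_sum, sq_euclNorm, Finset.mul_sum]
        congr 1
        exact Finset.sum_congr rfl fun i _ => by ring
    _ ≤ exp (s ^ 2 / 2) := exp_le_exp.2 (mul_le_of_le_one_right (by positivity) hv)

lemma integral_exp_sub_le (hf : ∀ x y, |f x - f y| ≤ euclNorm (x - y)) (c : ℝ) :
    ∫ p, exp (c * (f p.2 - f p.1)) ∂(stdGaussian d).prod (stdGaussian d) ≤
      exp (π ^ 2 / 4 * c ^ 2 / 2) := by
  set P := (stdGaussian d).prod (stdGaussian d)
  have hlip := lipschitzWith_of_abs_sub_le_euclNorm hf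
  have hdiff : ∀ᵐ p ∂P, DifferentiableAt ℝ f p.1 :=
    Measure.quasiMeasurePreserving_fst.ae
      (stdGaussian_absolutelyContinuous.ae_le (hlip.ae_differentiableAt (μ := volume)))
  have hlim : ∀ᵐ p ∂P, Tendsto (fun n : ℕ =>
      c * (n + 1 : ℕ) * rotationIncrement f (π / 2 / (n + 1 : ℕ)) p) atTop
      (𝓝 (c * (π / 2) * fderiv ℝ f p.1 p.2)) := by
    filter_upwards [hdiff] with p hp
    simpa only [mul_assoc] using (tendsto_mul_rotationIncrement hp).const_mul c
  have hmeas (n : ℕ) : AEStronglyMeasurable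
      (fun p => c * (n + 1 : ℕ) * rotationIncrement f (π / 2 / (n + 1 : ℕ)) p) P := by
    have := continuous_rotationIncrement hlip.continuous (π / 2 / (n + 1 : ℕ))
    fun_prop
  have hbound (n : ℕ) (p : (Fin d → ℝ) × (Fin d → ℝ)) :
      ‖exp (c * (n + 1 : ℕ) * rotationIncrement f (π / 2 / (n + 1 : ℕ)) p)‖ ≤
        exp (|c| * (π / 2) * (euclNorm p.1 + euclNorm p.2)) := by
    rw [Real.norm_of_nonneg (exp_pos _).le, exp_le_exp]
    have h0 : (0 : ℝ) < (n + 1 : ℕ) := by positivity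
    have h1 := abs_rotationIncrement_le hf (π / 2 / (n + 1 : ℕ)) p
    rw [abs_of_pos (by positivity : (0 : ℝ) < π / 2 / (n + 1 : ℕ))] at h1
    calc c * (n + 1 : ℕ) * rotationIncrement f (π / 2 / (n + 1 : ℕ)) p
        ≤ |c| * (n + 1 : ℕ) * |rotationIncrement f (π / 2 / (n + 1 : ℕ)) p| := by
          refine (le_abs_self _).trans_eq ?_
          rw [abs_mul, abs_mul, Nat.abs_cast]
      _ ≤ |c| * (n + 1 : ℕ) * (π / 2 / (n + 1 : ℕ) * (euclNorm p.1 + euclNorm p.2)) :=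
          mul_le_mul_of_nonneg_left h1 (by positivity)
      _ = |c| * (π / 2) * (euclNorm p.1 + euclNorm p.2) := by
          rw [mul_assoc |c|, ← mul_assoc _ (π / 2 / _), mul_div_cancel₀ _ h0.ne', ← mul_assoc]
  have hexplim : ∀ᵐ p ∂P, Tendsto (fun n : ℕ =>
      exp (c * (n + 1 : ℕ) * rotationIncrement f (π / 2 / (n + 1 : ℕ)) p)) atTop
      (𝓝 (exp (c * (π / 2) * fderiv ℝ f p.1 p.2))) := by
    filter_upwards [hlim] with p hp using (continuous_exp.tendsto _).comp hp
  have hdom := tendsto_integral_of_dominated_convergence _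
    (fun n => continuous_exp.comp_aestronglyMeasurable (hmeas n))
    (integrable_exp_mul_euclNorm_add_euclNorm (|c| * (π / 2)))
    (fun n => ae_of_all _ (hbound n)) hexplim
  have hfd : Integrable (fun p => exp (c * (π / 2) * fderiv ℝ f p.1 p.2)) P := by
    refine integrable_exp_of_abs_le (|c| * (π / 2))
      (aestronglyMeasurable_of_tendsto_ae _ hmeas hlim) fun p => ?_
    rw [abs_mul, abs_mul, abs_of_pos (by positivity : 0 < π / 2)]
    gcongr
    exact (abs_fderiv_apply_le hf _ _).trans (le_add_of_nonneg_left (euclNorm_nonneg _))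
  calc ∫ p, exp (c * (f p.2 - f p.1)) ∂P = ∫ p, exp (c * rotationIncrement f (π / 2) p) ∂P := by
        simp [rotationIncrement]
    _ ≤ ∫ p, exp (c * (π / 2) * fderiv ℝ f p.1 p.2) ∂P :=
        ge_of_tendsto hdom (Eventually.of_forall fun n =>
          integral_exp_sub_le_integral_exp_rotationIncrement hf c n.succ_ne_zero)
    _ = ∫ x, ∫ y, exp (c * (π / 2) * fderiv ℝ f x y) ∂stdGaussian d ∂stdGaussian d :=
        integral_prod _ hfd
    _ ≤ ∫ _x, exp (π ^ 2 / 4 * c ^ 2 / 2) ∂stdGaussian d := by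
        refine integral_mono hfd.integral_prod_left (integrable_const _) fun x => ?_
        refine (integral_exp_clm_le (fderiv ℝ f x) (abs_fderiv_apply_le hf x) _).trans_eq ?_
        ring_nf
    _ = exp (π ^ 2 / 4 * c ^ 2 / 2) := by simp

lemma integrable_of_abs_sub_le_euclNorm (hf : ∀ x y, |f x - f y| ≤ euclNorm (x - y)) :
    Integrable f (stdGaussian d) := by
  refine ((integrable_exp_mul_euclNorm (d := d) 1).add (integrable_const |f 0|)).mono'
    (lipschitzWith_of_abs_sub_le_euclNorm hf).continuous.aestronglyMeasurable
    (ae_of_all _ fun x => ?_)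
  have h1 := hf x 0
  have h2 := add_one_le_exp (1 * euclNorm x)
  have h3 := abs_sub_abs_le_abs_sub (f x) (f 0)
  simp only [sub_zero, one_mul, Pi.add_apply, Real.norm_eq_abs] at *
  linarith

/-- **Gaussian concentration**: a `1`-Lipschitz function of a standard Gaussian vector is
sub-Gaussian around its mean. -/
theorem hasSubgaussianMGF_of_abs_sub_le_euclNorm
    (hf : ∀ x y, |f x - f y| ≤ euclNorm (x - y)) :
    HasSubgaussianMGF (fun x => f x - ∫ z, f z ∂stdGaussian d) (π ^ 2 / 4).toNNReal
      (stdGaussian d) := by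
  have hfi := integrable_of_abs_sub_le_euclNorm hf
  have hcont := (lipschitzWith_of_abs_sub_le_euclNorm hf).continuous
  set E := ∫ z, f z ∂stdGaussian d
  have hint (c : ℝ) : Integrable (fun x => exp (c * (f x - E))) (stdGaussian d) := by
    refine ((integrable_exp_mul_euclNorm (d := d) |c|).const_mul (exp (|c| * |f 0 - E|))).mono'
      (by fun_prop) (ae_of_all _ fun x => ?_)
    rw [Real.norm_of_nonneg (exp_pos _).le, ← exp_add, exp_le_exp, ← mul_add]
    have h1 : |f x - E| ≤ |f 0 - E| + euclNorm x := by
      have h2 := hf x 0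
      have h3 := abs_add_le (f x - f 0) (f 0 - E)
      simp only [sub_zero, sub_add_sub_cancel] at h2 h3
      linarith
    calc c * (f x - E) ≤ |c| * |f x - E| := by rw [← abs_mul]; exact le_abs_self _
      _ ≤ |c| * (|f 0 - E| + euclNorm x) := by gcongr
  refine ⟨hint, fun c => ?_⟩
  rw [Real.coe_toNNReal _ (by positivity)]
  have hprod : ∫ p, exp (c * (f p.2 - f p.1)) ∂(stdGaussian d).prod (stdGaussian d) =
      (∫ x, exp (-c * (f x - E)) ∂stdGaussian d) * ∫ x, exp (c * (f x - E)) ∂stdGaussian d := by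
    rw [← integral_prod_mul]
    congr 1 with p
    rw [← exp_add]
    congr 1
    ring
  have hone : 1 ≤ ∫ x, exp (-c * (f x - E)) ∂stdGaussian d := by
    calc (1 : ℝ) = ∫ x, (-c * (f x - E) + 1) ∂stdGaussian d := by
          have hsub : Integrable (fun x => f x - E) (stdGaussian d) := hfi.sub (integrable_const E)
          rw [integral_add (hsub.const_mul _) (integrable_const _), integral_const_mul,
            integral_sub hfi (integrable_const E)]
          simp [E]
      _ ≤ _ := integral_mono (((hfi.sub (integrable_const E)).const_mul _).add
          (integrable_const _)) (hint _) fun x => add_one_le_exp _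
  calc mgf (fun x => f x - E) (stdGaussian d) c
      ≤ (∫ x, exp (-c * (f x - E)) ∂stdGaussian d) *
        ∫ x, exp (c * (f x - E)) ∂stdGaussian d :=
        le_mul_of_one_le_left (integral_nonneg fun x => (exp_pos _).le) hone
    _ ≤ exp (π ^ 2 / 4 * c ^ 2 / 2) := hprod ▸ integral_exp_sub_le hf c

lemma measureReal_le_abs_sub_integral_le (hf : ∀ x y, |f x - f y| ≤ euclNorm (x - y)) {s : ℝ}
    (hs : 0 ≤ s) :
    (stdGaussian d).real {x | s ≤ |f x - ∫ z, f z ∂stdGaussian d|} ≤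
      2 * exp (-(2 / π ^ 2) * s ^ 2) := by
  have h := hasSubgaussianMGF_of_abs_sub_le_euclNorm hf
  have h1 := h.measure_ge_le hs
  have h2 := h.neg.measure_ge_le hs
  have hexp : -s ^ 2 / (2 * ((π ^ 2 / 4).toNNReal : ℝ)) = -(2 / π ^ 2) * s ^ 2 := by
    rw [Real.coe_toNNReal _ (by positivity)]; field_simp; norm_num
  rw [hexp] at h1 h2
  calc (stdGaussian d).real {x | s ≤ |f x - ∫ z, f z ∂stdGaussian d|}
      ≤ (stdGaussian d).real ({x | s ≤ f x - ∫ z, f z ∂stdGaussian d} ∪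
          {x | s ≤ -(f x - ∫ z, f z ∂stdGaussian d)}) :=
        measureReal_mono fun x (hx : s ≤ |_|) => le_abs.1 hx
    _ ≤ _ := measureReal_union_le _ _
    _ ≤ 2 * exp (-(2 / π ^ 2) * s ^ 2) := by
        rw [two_mul]; exact add_le_add h1 h2

/-- The mean absolute deviation of a `1`-Lipschitz function of a Gaussian vector is bounded. -/
lemma integral_abs_sub_integral_le (hf : ∀ x y, |f x - f y| ≤ euclNorm (x - y)) :
    ∫ x, |f x - ∫ z, f z ∂stdGaussian d| ∂stdGaussian d ≤ 2 * exp (π ^ 2 / 8) := by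
  have h := hasSubgaussianMGF_of_abs_sub_le_euclNorm hf
  set g : (Fin d → ℝ) → ℝ := fun x => f x - ∫ z, f z ∂stdGaussian d
  have hexp (c : ℝ) (hc : c ^ 2 = 1) : ∫ x, exp (c * g x) ∂stdGaussian d ≤ exp (π ^ 2 / 8) := by
    refine (h.mgf_le c).trans_eq ?_
    rw [Real.coe_toNNReal _ (by positivity), hc]; ring_nf
  calc ∫ x, |g x| ∂stdGaussian d ≤ ∫ x, (exp (1 * g x) + exp (-1 * g x)) ∂stdGaussian d := by
        refine integral_mono h.integrable.abs
          ((h.integrable_exp_mul 1).add (h.integrable_exp_mul (-1))) fun x => ?_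
        simp only [one_mul, neg_mul]
        have h1 := add_one_le_exp (g x)
        have h2 := add_one_le_exp (-g x)
        rcases abs_cases (g x) with ⟨h3, _⟩ | ⟨h3, _⟩ <;> rw [h3] <;>
          linarith [exp_pos (g x), exp_pos (-g x)]
    _ ≤ 2 * exp (π ^ 2 / 8) := by
        rw [integral_add (h.integrable_exp_mul 1) (h.integrable_exp_mul (-1)), two_mul]
        exact add_le_add (hexp 1 (by norm_num)) (hexp (-1) (by norm_num))

end Concentration

section GaussianNorm

/-- The first absolute moment of a standard Gaussian variable. -/
noncomputable def gaussianAbsMoment : ℝ := ∫ x, |x| ∂gaussianReal 0 1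

lemma integrable_id_gaussianReal_std : Integrable (fun x : ℝ => x) (gaussianReal 0 1) :=
  (memLp_id_gaussianReal 1).integrable le_rfl

lemma gaussianAbsMoment_pos : 0 < gaussianAbsMoment := by
  have := nullSingletonClass_gaussianReal (μ := 0) (v := 1) one_ne_zero
  rw [gaussianAbsMoment, integral_pos_iff_support_of_nonneg (fun x => abs_nonneg x)
    integrable_id_gaussianReal_std.abs]
  have : Function.support (fun x : ℝ => |x|) = {0}ᶜ := by ext; simp
  rw [this, prob_compl_eq_one_iff (measurableSet_singleton 0) |>.2 (measure_singleton 0)]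
  exact one_pos

variable {m : ℕ}

lemma integrable_euclNorm : Integrable (euclNorm : (Fin m → ℝ) → ℝ) (stdGaussian m) :=
  integrable_of_abs_sub_le_euclNorm abs_euclNorm_sub_euclNorm_le

lemma gaussianAbsMoment_mul_sqrt_le (m : ℕ) :
    gaussianAbsMoment * √m ≤ ∫ z, euclNorm z ∂stdGaussian m := by
  rcases m.eq_zero_or_pos with rfl | hm
  · simpa using integral_nonneg fun z => euclNorm_nonneg z
  have hm' : 0 < √(m : ℝ) := Real.sqrt_pos.2 (by exact_mod_cast hm)
  refine le_of_mul_le_mul_left ?_ hm'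
  have hint (i : Fin m) : Integrable (fun z : Fin m → ℝ => |z i|) (stdGaussian m) :=
    (measurePreserving_eval_stdGaussian i).integrable_comp_of_integrable
      integrable_id_gaussianReal_std.abs
  calc √(m : ℝ) * (gaussianAbsMoment * √m) = ∑ _i : Fin m, gaussianAbsMoment := by
        rw [mul_comm gaussianAbsMoment, ← mul_assoc, Real.mul_self_sqrt (Nat.cast_nonneg m)]; simp
    _ = ∫ z : Fin m → ℝ, ∑ i, |z i| ∂stdGaussian m := by
        rw [integral_finsetSum _ fun i _ => hint i]
        refine Finset.sum_congr rfl fun i _ => ?_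
        rw [integral_comp_eval_stdGaussian (fun x => |x|) (by fun_prop), gaussianAbsMoment]
    _ ≤ ∫ z, √(m : ℝ) * euclNorm z ∂stdGaussian m :=
        integral_mono (integrable_finsetSum _ fun i _ => hint i) (integrable_euclNorm.const_mul _)
          fun z => sum_abs_le_sqrt_mul_euclNorm z
    _ = √(m : ℝ) * ∫ z, euclNorm z ∂stdGaussian m := integral_const_mul _ _

lemma integral_euclNorm_le_sqrt (hm : 1 ≤ m) : ∫ z, euclNorm z ∂stdGaussian m ≤ √m := by
  have hq : 0 < √(m : ℝ) := Real.sqrt_pos.2 (by exact_mod_cast hm)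
  have hsq : √(m : ℝ) * √m = m := Real.mul_self_sqrt (Nat.cast_nonneg m)
  have hint1 : Integrable (fun x : ℝ => x ^ 2) (gaussianReal 0 1) :=
    (memLp_id_gaussianReal 2).integrable_sq
  have hint (i : Fin m) : Integrable (fun z : Fin m → ℝ => z i ^ 2) (stdGaussian m) :=
    (measurePreserving_eval_stdGaussian i).integrable_comp_of_integrable hint1
  have hone : ∫ x, x ^ 2 ∂gaussianReal 0 1 = 1 := by
    have := variance_fun_id_gaussianReal (μ := 0) (v := 1)
    rwa [variance_of_integral_eq_zero (by fun_prop) integral_id_gaussianReal] at this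
  have hsum : ∫ z : Fin m → ℝ, ∑ i, z i ^ 2 ∂stdGaussian m = m := by
    rw [integral_finsetSum _ fun i _ => hint i]
    simp only [integral_comp_eval_stdGaussian (fun x => x ^ 2) (by fun_prop), hone]
    simp
  have hle : ∫ z, 2 * √m * euclNorm z ∂stdGaussian m ≤
      ∫ z : Fin m → ℝ, (∑ i, z i ^ 2 + m) ∂stdGaussian m := by
    refine integral_mono (integrable_euclNorm.const_mul _)
      ((integrable_finsetSum _ fun i _ => hint i).add (integrable_const _)) fun z => ?_
    simp only [← sq_euclNorm]
    nlinarith [sq_nonneg (euclNorm z - √m)]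
  rw [integral_const_mul, integral_add (integrable_finsetSum _ fun i _ => hint i)
    (integrable_const _), hsum, integral_const] at hle
  simp only [probReal_univ, one_smul] at hle
  nlinarith

/-- Comparison of the Gaussian measures of a set and of its dilation. -/
lemma stdGaussian_dilation_le {l R : ℝ} (hl : 1 ≤ l) {A B : Set (Fin m → ℝ)}
    (hB : MeasurableSet B) (hBA : ∀ z ∈ B, l • z ∈ A) (hBR : ∀ z ∈ B, euclNorm z ≤ R) :
    ENNReal.ofReal (l ^ m * exp (-((l ^ 2 - 1) * R ^ 2 / 2))) * stdGaussian m B ≤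
      stdGaussian m A := by
  have hl0 : 0 < l := one_pos.trans_le hl
  set p : (Fin m → ℝ) → ENNReal := fun x => ENNReal.ofReal (∏ i, gaussianPDFReal 0 1 (x i))
  have hp : Measurable p := by
    have := measurable_gaussianPDFReal 0 1
    fun_prop
  have hpl (z) (hz : z ∈ B) :
      ENNReal.ofReal (exp (-((l ^ 2 - 1) * R ^ 2 / 2))) * p z ≤ p (l • z) := by
    simp only [p, prod_gaussianPDFReal_eq]
    rw [← ENNReal.ofReal_mul (exp_pos _).le, mul_left_comm, ← exp_add, euclNorm_smul,
      abs_of_pos hl0]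
    refine ENNReal.ofReal_le_ofReal (mul_le_mul_of_nonneg_left (exp_le_exp.2 ?_) (by positivity))
    have h1 : euclNorm z ^ 2 ≤ R ^ 2 := pow_le_pow_left₀ (euclNorm_nonneg z) (hBR z hz) 2
    have h2 : 0 ≤ l ^ 2 - 1 := by nlinarith
    nlinarith [mul_le_mul_of_nonneg_left h1 h2]
  let e : (Fin m → ℝ) ≃ᵐ (Fin m → ℝ) := MeasurableEquiv.smul₀ l hl0.ne'
  have hmap : Measure.map e volume = ENNReal.ofReal ((l ^ m)⁻¹) • volume := by
    have := Measure.map_addHaar_smul (volume : Measure (Fin m → ℝ)) hl0.ne'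
    change Measure.map (fun x => l • x) volume = _
    simpa [abs_of_pos hl0] using this
  have hcv : ∫⁻ z in B, p (l • z) =
      ENNReal.ofReal ((l ^ m)⁻¹) * ∫⁻ x in e '' B, p x := by
    have h1 : ∫⁻ x in e '' B, p x ∂(Measure.map e volume) = ∫⁻ z in B, p (l • z) := by
      rw [setLIntegral_map (e.measurableSet_image.2 hB) hp e.measurable,
        e.injective.preimage_image]
      rfl
    rw [← h1, hmap, Measure.restrict_smul, lintegral_smul_measure, smul_eq_mul]
  rw [stdGaussian_eq_withDensity]
  change _ * volume.withDensity p B ≤ volume.withDensity p A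
  calc ENNReal.ofReal (l ^ m * exp (-((l ^ 2 - 1) * R ^ 2 / 2))) * volume.withDensity p B
      = ENNReal.ofReal (l ^ m) *
        ∫⁻ z in B, ENNReal.ofReal (exp (-((l ^ 2 - 1) * R ^ 2 / 2))) * p z := by
        rw [withDensity_apply _ hB, lintegral_const_mul _ hp, ENNReal.ofReal_mul (by positivity),
          mul_assoc]
    _ ≤ ENNReal.ofReal (l ^ m) * ∫⁻ z in B, p (l • z) := by
        exact mul_le_mul' le_rfl (setLIntegral_mono' hB hpl)
    _ = volume.withDensity p (e '' B) := by
        rw [hcv, ← mul_assoc, ← ENNReal.ofReal_mul (by positivity),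
          mul_inv_cancel₀ (by positivity), ENNReal.ofReal_one, one_mul,
          withDensity_apply _ (e.measurableSet_image.2 hB)]
    _ ≤ volume.withDensity p A := measure_mono (Set.image_subset_iff.2 hBA)

lemma le_gaussianReal_Ioi {s : ℝ} (hs : 0 ≤ s) :
    ENNReal.ofReal ((√(2 * π))⁻¹ * exp (-(s + 1) ^ 2 / 2)) ≤ gaussianReal 0 1 (Set.Ioi s) := by
  calc ENNReal.ofReal ((√(2 * π))⁻¹ * exp (-(s + 1) ^ 2 / 2))
      = ∫⁻ _x in Set.Ioc s (s + 1),
          ENNReal.ofReal ((√(2 * π))⁻¹ * exp (-(s + 1) ^ 2 / 2)) := by simp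
    _ ≤ ∫⁻ x in Set.Ioc s (s + 1), gaussianPDF 0 1 x := by
        refine setLIntegral_mono' measurableSet_Ioc fun x hx => ?_
        rw [gaussianPDF_def, gaussianPDFReal_def]
        refine ENNReal.ofReal_le_ofReal ?_
        simp only [NNReal.coe_one, mul_one, sub_zero]
        have : x ^ 2 ≤ (s + 1) ^ 2 := pow_le_pow_left₀ (hs.trans hx.1.le) hx.2 2
        gcongr
    _ ≤ gaussianReal 0 1 (Set.Ioi s) := by
        rw [gaussianReal_apply 0 one_ne_zero]
        exact lintegral_mono_set Set.Ioc_subset_Ioi_self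

lemma le_stdGaussian_lt_euclNorm (hm : 1 ≤ m) {s : ℝ} (hs : 0 ≤ s) :
    ENNReal.ofReal ((√(2 * π))⁻¹ * exp (-(s + 1) ^ 2 / 2)) ≤
      stdGaussian m {z | s < euclNorm z} := by
  refine (le_gaussianReal_Ioi hs).trans ?_
  rw [← (measurePreserving_eval_stdGaussian (⟨0, hm⟩ : Fin m)).measure_preimage
    measurableSet_Ioi.nullMeasurableSet]
  exact measure_mono fun z (hz : s < z _) =>
    hz.trans_le ((le_abs_self _).trans (abs_apply_le_euclNorm z _))

/-- The exponent produced by dilating a Gaussian vector of dimension `q ^ 2` by `1 + ρ / q`. -/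
lemma dilation_exponent_le {q ρ K : ℝ} (hq : 1 ≤ q) (hρ : 0 ≤ ρ) (hK : 0 ≤ K) :
    -((1 + K + K ^ 2) * ρ ^ 2 + (2 * K + K ^ 2) * ρ) ≤
      q ^ 2 * (ρ / q - (ρ / q) ^ 2 / 2) - ((1 + ρ / q) ^ 2 - 1) * (q + K) ^ 2 / 2 := by
  obtain ⟨u, rfl⟩ : ∃ u, ρ = u * q := ⟨ρ / q, by field_simp⟩
  have hu : 0 ≤ u := nonneg_of_mul_nonneg_left hρ (by linarith)
  rw [mul_div_cancel_right₀ _ (by positivity)]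
  have h1 : 0 ≤ q - 1 := by linarith
  have h2 : 0 ≤ q ^ 2 - 1 := by nlinarith
  have h3 : 0 ≤ q ^ 2 - q := by nlinarith
  nlinarith [mul_nonneg (mul_nonneg hu (sq_nonneg K)) h1,
    mul_nonneg (mul_nonneg (sq_nonneg u) (sq_nonneg K)) h2,
    mul_nonneg (mul_nonneg (sq_nonneg u) (sq_nonneg K)) (sq_nonneg q),
    mul_nonneg (mul_nonneg (sq_nonneg u) hK) h3]

lemma exp_mul_sub_sq_le_one_add_pow {u : ℝ} (hu : 0 ≤ u) (m : ℕ) :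
    exp (m * (u - u ^ 2 / 2)) ≤ (1 + u) ^ m := by
  have h : u - u ^ 2 / 2 ≤ log (1 + u) := by
    refine le_trans ?_ (Real.le_log_one_add_of_nonneg hu)
    rw [le_div_iff₀ (by positivity)]
    nlinarith [pow_nonneg hu 3]
  calc exp (m * (u - u ^ 2 / 2)) ≤ exp (m * log (1 + u)) := by gcongr
    _ = (1 + u) ^ m := by rw [exp_nat_mul, exp_log (by positivity)]

/-- The Euclidean norm of a Gaussian vector has a Gaussian lower bound for its upper tail, uniformly
in the dimension. -/
theorem exists_le_stdGaussian_integral_add_lt_euclNorm :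
    ∃ c > (0 : ℝ), ∃ C > (0 : ℝ), ∀ m : ℕ, 1 ≤ m → ∀ r : ℝ, 0 ≤ r →
      ENNReal.ofReal (c * exp (-C * r ^ 2)) ≤
        stdGaussian m {z | ∫ w, euclNorm w ∂stdGaussian m + r < euclNorm z} := by
  set a := gaussianAbsMoment
  have ha : 0 < a := gaussianAbsMoment_pos
  set L : ℝ := 2 * π / a + 1
  set D : ℝ := 2 * (π + 1) / a
  set B : ℝ := (1 + π + π ^ 2) * D ^ 2 + (2 * π + π ^ 2) * D
  have hL : 0 < L := by positivity
  have hD : 0 < D := by positivity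
  have hB : 0 < B := by positivity
  have hs2π : 0 < (√(2 * π))⁻¹ := by positivity
  refine ⟨min ((√(2 * π))⁻¹ * exp (-L ^ 2)) (exp (-(2 * B)) / 2), by positivity,
    max 1 (2 * B), by positivity, fun m hm r hr => ?_⟩
  set μ := ∫ w, euclNorm w ∂stdGaussian m
  have hμ0 : 0 ≤ μ := integral_nonneg fun z => euclNorm_nonneg z
  have hμq : μ ≤ √m := integral_euclNorm_le_sqrt hm
  have haμ : a * √m ≤ μ := gaussianAbsMoment_mul_sqrt_le m
  have hq : 1 ≤ √(m : ℝ) := Real.one_le_sqrt.2 (by exact_mod_cast hm)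
  have hqm : √(m : ℝ) ^ 2 = m := Real.sq_sqrt (Nat.cast_nonneg m)
  rcases lt_or_ge (√(m : ℝ)) (2 * π / a) with hsmall | hlarge
  · refine le_trans (ENNReal.ofReal_le_ofReal ?_) (le_stdGaussian_lt_euclNorm hm (by positivity))
    calc min ((√(2 * π))⁻¹ * exp (-L ^ 2)) (exp (-(2 * B)) / 2) * exp (-max 1 (2 * B) * r ^ 2)
        ≤ (√(2 * π))⁻¹ * exp (-L ^ 2) * exp (-1 * r ^ 2) := by
          gcongr
          · exact min_le_left _ _
          · exact le_max_left _ _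
      _ ≤ (√(2 * π))⁻¹ * exp (-(μ + r + 1) ^ 2 / 2) := by
          rw [mul_assoc, ← exp_add]
          gcongr
          have : μ + r + 1 ≤ L + r := by simp only [L]; linarith
          have : (μ + r + 1) ^ 2 ≤ (L + r) ^ 2 := pow_le_pow_left₀ (by positivity) this 2
          nlinarith [sq_nonneg (L - r)]
  · set ρ : ℝ := 2 * (r + π + 1) / a
    have hρ : 0 ≤ ρ := by positivity
    have hρD : ρ ≤ D * (1 + r) := by
      simp only [ρ, D]
      rw [div_mul_eq_mul_div]
      exact div_le_div_of_nonneg_right (by nlinarith [mul_nonneg pi_pos.le hr]) ha.le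
    set S : Set (Fin m → ℝ) := {z | |euclNorm z - μ| < π}
    have hS : MeasurableSet S := by
      have := (continuous_euclNorm (d := m)).measurable
      exact measurableSet_lt (by fun_prop) measurable_const
    have hSc : 1 / 2 ≤ (stdGaussian m).real S := by
      have h1 := measureReal_le_abs_sub_integral_le
        (abs_euclNorm_sub_euclNorm_le (d := m)) pi_pos.le
      have h2 : {z : Fin m → ℝ | π ≤ |euclNorm z - ∫ w, euclNorm w ∂stdGaussian m|} = Sᶜ := by
        ext z; simp [S, μ]
      rw [h2, probReal_compl_eq_one_sub hS] at h1
      have h3 : exp (-(2 / π ^ 2) * π ^ 2) ≤ 1 / 4 := by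
        rw [neg_mul, div_mul_cancel₀ _ (by positivity), exp_neg, one_div]
        gcongr
        have h4 : (2 : ℝ) ≤ exp 1 := by linarith [add_one_le_exp (1 : ℝ)]
        calc (4 : ℝ) = 2 * 2 := by norm_num
          _ ≤ exp 1 * exp 1 := by gcongr
          _ = exp 2 := by rw [← exp_add]; norm_num
      linarith
    have hdil := stdGaussian_dilation_le (m := m) (l := 1 + ρ / √m) (R := √m + π)
      (A := {z | μ + r < euclNorm z}) (B := S) (by linarith [show 0 ≤ ρ / √(m : ℝ) by positivity])
      hS
      (fun z (hz : |euclNorm z - μ| < π) => by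
        have h1 := (abs_lt.1 hz).1
        rw [Set.mem_ofPred_eq, euclNorm_smul, abs_of_nonneg (by positivity)]
        have h2 : r + π + 1 ≤ ρ / √m * (μ - π) := by
          have h3 : a / 2 * √m ≤ μ - π := by
            have : π ≤ a / 2 * √m := by
              rw [div_le_iff₀ ha] at hlarge; linarith
            linarith
          calc r + π + 1 = ρ / √m * (a / 2 * √m) := by simp only [ρ]; field_simp
            _ ≤ ρ / √m * (μ - π) := by gcongr
        have h4 : ρ / √m * (μ - π) ≤ ρ / √m * euclNorm z := by
          gcongr; linarith
        linarith)
      (fun z (hz : |euclNorm z - μ| < π) => by linarith [(abs_lt.1 hz).2])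
    refine le_trans ?_ hdil
    rw [← ofReal_measureReal, ← ENNReal.ofReal_mul (by positivity)]
    refine ENNReal.ofReal_le_ofReal ?_
    have hexp : -(B * (1 + r) ^ 2) ≤ √(m : ℝ) ^ 2 * (ρ / √m - (ρ / √m) ^ 2 / 2) -
        ((1 + ρ / √m) ^ 2 - 1) * (√m + π) ^ 2 / 2 := by
      refine le_trans ?_ (dilation_exponent_le hq hρ pi_pos.le)
      have h1 : ρ ^ 2 ≤ D ^ 2 * (1 + r) ^ 2 := by
        rw [← mul_pow]; exact pow_le_pow_left₀ hρ hρD 2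
      have h2 : ρ ≤ D * (1 + r) ^ 2 := by
        refine hρD.trans (mul_le_mul_of_nonneg_left ?_ hD.le)
        nlinarith
      have h3 := mul_le_mul_of_nonneg_left h1 (by positivity : 0 ≤ 1 + π + π ^ 2)
      have h4 := mul_le_mul_of_nonneg_left h2 (by positivity : 0 ≤ 2 * π + π ^ 2)
      simp only [B]
      linarith
    calc min ((√(2 * π))⁻¹ * exp (-L ^ 2)) (exp (-(2 * B)) / 2) * exp (-max 1 (2 * B) * r ^ 2)
        ≤ exp (-(2 * B)) / 2 * exp (-(2 * B) * r ^ 2) := by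
          gcongr
          · exact min_le_right _ _
          · exact le_max_right _ _
      _ = exp (-(2 * B * (1 + r ^ 2))) * (1 / 2) := by
          rw [div_mul_eq_mul_div, ← exp_add]; ring_nf
      _ ≤ exp (-(B * (1 + r) ^ 2)) * (1 / 2) := by
          refine mul_le_mul_of_nonneg_right (exp_le_exp.2 ?_) (by norm_num)
          nlinarith [mul_nonneg hB.le (sq_nonneg (1 - r))]
      _ ≤ (1 + ρ / √m) ^ m * exp (-(((1 + ρ / √m) ^ 2 - 1) * (√m + π) ^ 2 / 2)) * (1 / 2) := by
          gcongr
          refine (exp_le_exp.2 hexp).trans ?_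
          rw [sub_eq_add_neg, exp_add, hqm]
          gcongr
          exact exp_mul_sub_sq_le_one_add_pow (by positivity) m
      _ ≤ _ := by gcongr

end GaussianNorm

section Norm

variable {n m : ℕ} {N : (Fin n → ℝ) → ℝ}

lemma norm_apply_zero (hsmul : ∀ (r : ℝ) (x), N (r • x) = |r| * N x) : N 0 = 0 := by
  simpa using hsmul 0 0

lemma norm_apply_nonneg (hadd : ∀ x y, N (x + y) ≤ N x + N y)
    (hsmul : ∀ (r : ℝ) (x), N (r • x) = |r| * N x) (x : Fin n → ℝ) : 0 ≤ N x := by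
  have h1 := hadd x ((-1 : ℝ) • x)
  have h2 : x + (-1 : ℝ) • x = 0 := by module
  rw [h2, norm_apply_zero hsmul, hsmul] at h1
  norm_num at h1
  exact h1

lemma norm_apply_le_euclNorm (hsmul : ∀ (r : ℝ) (x), N (r • x) = |r| * N x)
    (hball : ∀ x, euclNorm x ≤ 1 → N x ≤ 1) (x : Fin n → ℝ) : N x ≤ euclNorm x := by
  rcases (euclNorm_nonneg x).eq_or_lt with h | h
  · have hx : x = 0 := by
      ext i
      simpa [← h] using abs_apply_le_euclNorm x i
    rw [← h, hx, norm_apply_zero hsmul]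
  · have h1 := hball ((euclNorm x)⁻¹ • x) (by
      rw [euclNorm_smul, abs_of_pos (inv_pos.2 h), inv_mul_cancel₀ h.ne'])
    rw [hsmul, abs_of_pos (inv_pos.2 h)] at h1
    rwa [inv_mul_le_iff₀ h, mul_one] at h1

lemma abs_norm_apply_sub_le (hadd : ∀ x y, N (x + y) ≤ N x + N y)
    (hsmul : ∀ (r : ℝ) (x), N (r • x) = |r| * N x)
    (hball : ∀ x, euclNorm x ≤ 1 → N x ≤ 1) (x y : Fin n → ℝ) :
    |N x - N y| ≤ euclNorm (x - y) := by
  refine le_trans ?_ (norm_apply_le_euclNorm hsmul hball (x - y))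
  have h1 := hadd (x - y) y
  have h2 := hadd ((-1 : ℝ) • (x - y)) x
  have h3 : (-1 : ℝ) • (x - y) + x = y := by module
  rw [sub_add_cancel] at h1
  rw [h3, hsmul] at h2
  norm_num at h2
  exact abs_le.2 ⟨by linarith, by linarith⟩

lemma bConst_le_one (hball : ∀ x, euclNorm x ≤ 1 → N x ≤ 1) : bConst N ≤ 1 :=
  Real.sSup_le (by rintro s ⟨θ, hθ, rfl⟩; exact hball θ hθ.le) zero_le_one

lemma bConst_pos (hn : 1 ≤ n) (hadd : ∀ x y, N (x + y) ≤ N x + N y)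
    (hsmul : ∀ (r : ℝ) (x), N (r • x) = |r| * N x) (hdef : ∀ x, N x = 0 → x = 0)
    (hball : ∀ x, euclNorm x ≤ 1 → N x ≤ 1) : 0 < bConst N := by
  let θ : Fin n → ℝ := Pi.single ⟨0, hn⟩ 1
  have hθ : euclNorm θ = 1 := by
    rw [euclNorm_eq_norm_toLp]
    simp [θ]
  have hpos : 0 < N θ :=
    (norm_apply_nonneg hadd hsmul θ).lt_of_ne' fun h => by simpa [θ] using hdef θ h
  refine hpos.trans_le (le_csSup ⟨1, ?_⟩ ⟨θ, hθ, rfl⟩)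
  rintro s ⟨θ', hθ', rfl⟩
  exact hball θ' hθ'.le

lemma integral_norm_pos (hn : 1 ≤ n) (hadd : ∀ x y, N (x + y) ≤ N x + N y)
    (hsmul : ∀ (r : ℝ) (x), N (r • x) = |r| * N x) (hdef : ∀ x, N x = 0 → x = 0)
    (hball : ∀ x, euclNorm x ≤ 1 → N x ≤ 1) : 0 < ∫ x, N x ∂stdGaussian n := by
  have := Fin.pos_iff_nonempty.1 hn
  rw [integral_pos_iff_support_of_nonneg (norm_apply_nonneg hadd hsmul)
    (integrable_of_abs_sub_le_euclNorm (abs_norm_apply_sub_le hadd hsmul hball))]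
  have hsupp : Function.support N = {0}ᶜ := by
    ext x
    exact not_congr ⟨hdef x, fun h => h ▸ norm_apply_zero hsmul⟩
  rw [hsupp, (prob_compl_eq_one_iff (measurableSet_singleton 0)).2
    (stdGaussian_absolutelyContinuous (measure_singleton 0))]
  exact one_pos

lemma integral_norm_le_sqrt_critDim (hn : 1 ≤ n) (hadd : ∀ x y, N (x + y) ≤ N x + N y)
    (hsmul : ∀ (r : ℝ) (x), N (r • x) = |r| * N x) (hdef : ∀ x, N x = 0 → x = 0)
    (hball : ∀ x, euclNorm x ≤ 1 → N x ≤ 1) :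
    ∫ x, N x ∂stdGaussian n ≤ √(critDim n N) := by
  have hE := integral_norm_pos hn hadd hsmul hdef hball
  have hb := bConst_pos hn hadd hsmul hdef hball
  rw [critDim, Real.sqrt_sq (by positivity)]
  exact le_div_self hE.le hb (bConst_le_one hball)

lemma abs_normY_sub_le (hN : ∀ x y, |N x - N y| ≤ euclNorm (x - y)) (x y : Fin (n + m) → ℝ) :
    |normY n m N x - normY n m N y| ≤ euclNorm (x - y) :=
  (abs_max_sub_max_le_max _ _ _ _).trans (max_le
    ((hN _ _).trans (euclNorm_comp_le (Fin.castAdd_injective n m) (x - y)))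
    ((abs_euclNorm_sub_euclNorm_le _ _).trans
      (euclNorm_comp_le (Fin.natAdd_injective m n) (x - y))))

lemma integral_comp_of_abs_sub_le_euclNorm {k d : ℕ} {f : (Fin k → ℝ) → ℝ}
    (hf : ∀ x y, |f x - f y| ≤ euclNorm (x - y)) {e : Fin k → Fin d} (he : e.Injective) :
    Integrable (fun y => f (y ∘ e)) (stdGaussian d) ∧
      ∫ y, f (y ∘ e) ∂stdGaussian d = ∫ x, f x ∂stdGaussian k := by
  have hmp := measurePreserving_comp_stdGaussian he
  have hint := integrable_of_abs_sub_le_euclNorm hf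
  refine ⟨hmp.integrable_comp_of_integrable hint, ?_⟩
  have h := hint.aestronglyMeasurable
  rw [← hmp.map_eq] at h ⊢
  exact (integral_map hmp.aemeasurable h).symm

lemma integral_euclNorm_le_integral_normY (hN : ∀ x y, |N x - N y| ≤ euclNorm (x - y)) :
    ∫ z, euclNorm z ∂stdGaussian m ≤ ∫ y, normY n m N y ∂stdGaussian (n + m) := by
  obtain ⟨h1, h2⟩ := integral_comp_of_abs_sub_le_euclNorm
    (abs_euclNorm_sub_euclNorm_le (d := m)) (Fin.natAdd_injective m n)
  rw [← h2]
  exact integral_mono h1 (integrable_of_abs_sub_le_euclNorm (abs_normY_sub_le hN))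
    fun y => le_max_right _ _

lemma integral_normY_le_add (hN : ∀ x y, |N x - N y| ≤ euclNorm (x - y)) (hN0 : ∀ x, 0 ≤ N x) :
    ∫ y, normY n m N y ∂stdGaussian (n + m) ≤
      ∫ x, N x ∂stdGaussian n + ∫ z, euclNorm z ∂stdGaussian m := by
  obtain ⟨h1, h2⟩ := integral_comp_of_abs_sub_le_euclNorm hN (Fin.castAdd_injective n m)
  obtain ⟨h3, h4⟩ := integral_comp_of_abs_sub_le_euclNorm
    (abs_euclNorm_sub_euclNorm_le (d := m)) (Fin.natAdd_injective m n)
  rw [← h2, ← h4, ← integral_add h1 h3]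
  exact integral_mono (integrable_of_abs_sub_le_euclNorm (abs_normY_sub_le hN)) (h1.add h3)
    fun y => max_le_add_of_nonneg (hN0 _) (euclNorm_nonneg _)

/-- If the Euclidean part has the larger mean, then `E‖G‖_Y` exceeds this mean by at most a
constant. -/
lemma integral_normY_le (hN : ∀ x y, |N x - N y| ≤ euclNorm (x - y))
    (hle : ∫ x, N x ∂stdGaussian n ≤ ∫ z, euclNorm z ∂stdGaussian m) :
    ∫ y, normY n m N y ∂stdGaussian (n + m) ≤
      ∫ z, euclNorm z ∂stdGaussian m + 4 * exp (π ^ 2 / 8) := by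
  set μ := ∫ z, euclNorm z ∂stdGaussian m
  set ν := ∫ x, N x ∂stdGaussian n
  have hdev {k d : ℕ} {f : (Fin k → ℝ) → ℝ} (hf : ∀ x y, |f x - f y| ≤ euclNorm (x - y))
      {e : Fin k → Fin d} (he : e.Injective) :
      Integrable (fun y => |f (y ∘ e) - ∫ x, f x ∂stdGaussian k|) (stdGaussian d) ∧
        ∫ y, |f (y ∘ e) - ∫ x, f x ∂stdGaussian k| ∂stdGaussian d ≤ 2 * exp (π ^ 2 / 8) := by
    have hg : ∀ x y, |(|f x - ∫ z, f z ∂stdGaussian k|) - (|f y - ∫ z, f z ∂stdGaussian k|)|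
        ≤ euclNorm (x - y) := fun x y =>
      (abs_abs_sub_abs_le_abs_sub _ _).trans (by rw [sub_sub_sub_cancel_right]; exact hf x y)
    obtain ⟨h1, h2⟩ := integral_comp_of_abs_sub_le_euclNorm hg he
    exact ⟨h1, h2.trans_le (integral_abs_sub_integral_le hf)⟩
  obtain ⟨hi1, hd1⟩ := hdev hN (Fin.castAdd_injective n m)
  obtain ⟨hi2, hd2⟩ := hdev (abs_euclNorm_sub_euclNorm_le (d := m)) (Fin.natAdd_injective m n)
  have hi : Integrable (fun y : Fin (n + m) → ℝ => |N (y ∘ Fin.castAdd m) - ν| +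
      |euclNorm (y ∘ Fin.natAdd n) - μ|) (stdGaussian (n + m)) := hi1.add hi2
  calc ∫ y, normY n m N y ∂stdGaussian (n + m)
      ≤ ∫ y : Fin (n + m) → ℝ, (μ + (|N (y ∘ Fin.castAdd m) - ν| +
          |euclNorm (y ∘ Fin.natAdd n) - μ|)) ∂stdGaussian (n + m) := by
        refine integral_mono (integrable_of_abs_sub_le_euclNorm (abs_normY_sub_le hN))
          ((integrable_const μ).add hi) fun y => max_le ?_ ?_
        · have := le_abs_self (N (y ∘ Fin.castAdd m) - ν)
          have := abs_nonneg (euclNorm (y ∘ Fin.natAdd n) - μ)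
          change N (y ∘ Fin.castAdd m) ≤ _
          linarith
        · have := le_abs_self (euclNorm (y ∘ Fin.natAdd n) - μ)
          have := abs_nonneg (N (y ∘ Fin.castAdd m) - ν)
          change euclNorm (y ∘ Fin.natAdd n) ≤ _
          linarith
    _ ≤ μ + 4 * exp (π ^ 2 / 8) := by
        rw [integral_add (integrable_const μ) hi, integral_add hi1 hi2, integral_const,
          probReal_univ, one_smul]
        linarith

lemma stdGaussian_lt_euclNorm_le (N : (Fin n → ℝ) → ℝ) (s : ℝ) :
    stdGaussian m {z | s < euclNorm z} ≤
      stdGaussian (n + m) {y | s < normY n m N y} := by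
  have hmeas : MeasurableSet {z : Fin m → ℝ | s < euclNorm z} :=
    measurableSet_lt measurable_const continuous_euclNorm.measurable
  rw [← (measurePreserving_comp_stdGaussian (Fin.natAdd_injective m n)).measure_preimage
    hmeas.nullMeasurableSet]
  exact measure_mono fun y (hy : s < euclNorm _) => lt_max_of_lt_right hy

end Norm

/-- For `B_X` in John's position and `m ≃ k(X)`, the norm `‖·‖_Y` exhibits
`c exp(−C t² k(X)) ≤ P(| ‖G‖_Y − E‖G‖_Y | > t E‖G‖_Y) ≤ C exp(−c t² k(X))`. -/
theorem statement17 :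
    ∃ C > (0 : ℝ), ∃ c > (0 : ℝ), ∃ c₁ > (0 : ℝ), ∃ C₁ > (0 : ℝ),
      ∀ n : ℕ, 1 ≤ n → ∀ N : (Fin n → ℝ) → ℝ,
        (∀ x y, N (x + y) ≤ N x + N y) →
        (∀ (r : ℝ) (x), N (r • x) = |r| * N x) →
        (∀ x, N x = 0 → x = 0) →
        JohnPosition N →
        ∀ m : ℕ, c₁ * critDim n N ≤ (m : ℝ) → (m : ℝ) ≤ C₁ * critDim n N →
        ∀ t > (0 : ℝ),
          ENNReal.ofReal (c * Real.exp (-C * t ^ 2 * critDim n N)) ≤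
              stdGaussian (n + m)
                {y | t * (∫ z, normY n m N z ∂stdGaussian (n + m)) <
                      |normY n m N y - ∫ z, normY n m N z ∂stdGaussian (n + m)|} ∧
            stdGaussian (n + m)
                {y | t * (∫ z, normY n m N z ∂stdGaussian (n + m)) <
                      |normY n m N y - ∫ z, normY n m N z ∂stdGaussian (n + m)|}
              ≤ ENNReal.ofReal (C * Real.exp (-c * t ^ 2 * critDim n N)) := by
  obtain ⟨c₀, hc₀, C₀, hC₀, hlow⟩ := exists_le_stdGaussian_integral_add_lt_euclNorm
  have ha := gaussianAbsMoment_pos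
  set a := gaussianAbsMoment
  set δ : ℝ := 4 * exp (π ^ 2 / 8)
  refine ⟨max 2 (2 * C₀ * (8 / a ^ 2)), by positivity,
    min (2 / π ^ 2) (c₀ * exp (-(2 * C₀ * δ ^ 2))), by positivity,
    1 / a ^ 2, by positivity, 2 / a ^ 2, by positivity, ?_⟩
  intro n hn N hadd hsmul hdef hJ m hkm hmk t ht
  have hN := abs_norm_apply_sub_le hadd hsmul hJ.1
  have hEN := integral_norm_pos hn hadd hsmul hdef hJ.1
  have hENk := integral_norm_le_sqrt_critDim hn hadd hsmul hdef hJ.1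
  have hk : 0 < critDim n N := Real.sqrt_pos.1 (hEN.trans_le hENk)
  set k := critDim n N
  have hm : 1 ≤ m := by
    have : (0 : ℝ) < m := lt_of_lt_of_le (by positivity) hkm
    exact_mod_cast this
  have hμlow : √k ≤ ∫ z, euclNorm z ∂stdGaussian m := by
    refine le_trans ?_ (gaussianAbsMoment_mul_sqrt_le m)
    refine Real.sqrt_le_iff.2 ⟨by positivity, ?_⟩
    rw [mul_pow, Real.sq_sqrt (Nat.cast_nonneg m)]
    rwa [one_div, inv_mul_le_iff₀ (by positivity)] at hkm
  have hμup := integral_euclNorm_le_sqrt hm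
  have hμE := integral_euclNorm_le_integral_normY (m := m) hN
  have hEμ := integral_normY_le (m := m) hN (hENk.trans hμlow)
  have hEup : ∫ y, normY n m N y ∂stdGaussian (n + m) ≤ 2 * √m := by
    refine (integral_normY_le_add hN (norm_apply_nonneg hadd hsmul)).trans ?_
    linarith
  set μ := ∫ z, euclNorm z ∂stdGaussian m
  set E := ∫ y, normY n m N y ∂stdGaussian (n + m)
  have hEk : k ≤ E ^ 2 := by
    rw [← Real.sq_sqrt hk.le]
    exact pow_le_pow_left₀ (Real.sqrt_nonneg _) (hμlow.trans hμE) 2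
  have hE0 : 0 ≤ E := (Real.sqrt_nonneg k).trans (hμlow.trans hμE)
  have hkE : E ^ 2 ≤ 8 / a ^ 2 * k := by
    calc E ^ 2 ≤ (2 * √m) ^ 2 := pow_le_pow_left₀ hE0 hEup 2
      _ = 4 * m := by rw [mul_pow, Real.sq_sqrt (Nat.cast_nonneg m)]; norm_num
      _ ≤ 4 * (2 / a ^ 2 * k) := by gcongr
      _ = 8 / a ^ 2 * k := by ring
  constructor
  · calc ENNReal.ofReal (min (2 / π ^ 2) (c₀ * exp (-(2 * C₀ * δ ^ 2))) *
          exp (-max 2 (2 * C₀ * (8 / a ^ 2)) * t ^ 2 * k))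
        ≤ ENNReal.ofReal (c₀ * exp (-C₀ * (δ + t * E) ^ 2)) := by
          refine ENNReal.ofReal_le_ofReal ?_
          calc min (2 / π ^ 2) (c₀ * exp (-(2 * C₀ * δ ^ 2))) *
                exp (-max 2 (2 * C₀ * (8 / a ^ 2)) * t ^ 2 * k)
              ≤ c₀ * exp (-(2 * C₀ * δ ^ 2)) * exp (-(2 * C₀ * (8 / a ^ 2)) * t ^ 2 * k) := by
                gcongr
                · exact min_le_right _ _
                · exact le_max_right _ _
            _ ≤ c₀ * exp (-C₀ * (δ + t * E) ^ 2) := by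
                rw [mul_assoc, ← exp_add]
                refine mul_le_mul_of_nonneg_left (exp_le_exp.2 ?_) hc₀.le
                have h1 : (δ + t * E) ^ 2 ≤ 2 * δ ^ 2 + 2 * t ^ 2 * (8 / a ^ 2 * k) := by
                  have := mul_le_mul_of_nonneg_left hkE (sq_nonneg t)
                  nlinarith [sq_nonneg (δ - t * E)]
                linarith [mul_le_mul_of_nonneg_left h1 hC₀.le]
      _ ≤ stdGaussian m {z | μ + (δ + t * E) < euclNorm z} := hlow m hm _ (by positivity)
      _ ≤ stdGaussian (n + m) {y | μ + (δ + t * E) < normY n m N y} :=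
          stdGaussian_lt_euclNorm_le N _
      _ ≤ _ := measure_mono fun y (hy : μ + (δ + t * E) < normY n m N y) =>
          show t * E < |normY n m N y - E| from
            (by linarith : t * E < normY n m N y - E).trans_le (le_abs_self _)
  · calc stdGaussian (n + m) {y | t * E < |normY n m N y - E|}
        ≤ stdGaussian (n + m) {y | t * E ≤ |normY n m N y - E|} :=
          measure_mono fun y (hy : t * E < |normY n m N y - E|) => hy.le
      _ = ENNReal.ofReal
            ((stdGaussian (n + m)).real {y | t * E ≤ |normY n m N y - E|}) :=
          (ofReal_measureReal).symm
      _ ≤ ENNReal.ofReal (2 * exp (-(2 / π ^ 2) * (t * E) ^ 2)) :=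
          ENNReal.ofReal_le_ofReal
            (measureReal_le_abs_sub_integral_le (abs_normY_sub_le hN) (by positivity))
      _ ≤ _ := by
          refine ENNReal.ofReal_le_ofReal ?_
          have h1 : min (2 / π ^ 2) (c₀ * exp (-(2 * C₀ * δ ^ 2))) * (t ^ 2 * k) ≤
              2 / π ^ 2 * (t ^ 2 * E ^ 2) := by
            gcongr
            exact min_le_left _ _
          refine mul_le_mul (le_max_left _ _) (exp_le_exp.2 ?_) (exp_pos _).le (by positivity)
          linarith
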